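/- arXiv:2605.21811 — 8 statements merged into one kernel-verified Lean document; each statement's English description precedes it below -/
import Mathlib

section
/- Let f : ℝ^m → ℝ^n and h₀ : ℝ^n → ℝ be smooth, and let σ : [0,∞) → ℝ^m be twice continuously differentiable. Let p₁, p₂ > 0 and set κ₁ = p₁ p₂ and κ₂ = p₁ + p₂. Write φ(t) = h₀(f(σ(t))). Suppose that for every t ≥ 0 the pullback ECBF constraint holds: Σ_i ∂(h₀∘f)/∂σ^i (σ(t)) · σ̈^i(t) ≥ − Σ_{i,j} ∂²(h₀∘f)/∂σ^i ∂σ^j (σ(t)) · σ̇^i(t) σ̇^j(t) − κ₂ φ'(t) − κ₁ φ(t), and that φ(0) ≥ 0 and φ'(0) + p₁ φ(0) ≥ 0. Then φ(t) ≥ 0 for all t ≥ 0, i.e. h₀(f(σ(t))) ≥ 0 along the entire trajectory. -/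
/-- A function with `y' + p * y ≥ 0` on `[0, ∞)` and `y 0 ≥ 0` stays nonnegative. -/
theorem nonneg_of_hasDerivWithinAt_add_mul_nonneg {y y' : ℝ → ℝ} {p : ℝ}
    (hy : ∀ t ∈ Set.Ici (0 : ℝ), HasDerivWithinAt y (y' t) (Set.Ici 0) t)
    (hineq : ∀ t ∈ Set.Ici (0 : ℝ), 0 ≤ y' t + p * y t) (h0 : 0 ≤ y 0) :
    ∀ t ∈ Set.Ici (0 : ℝ), 0 ≤ y t := by
  have hd : ∀ t ∈ Set.Ici (0 : ℝ), HasDerivWithinAt (fun t => Real.exp (p * t) * y t)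
      (Real.exp (p * t) * (y' t + p * y t)) (Set.Ici 0) t := by
    intro t ht
    have he : HasDerivAt (fun t => Real.exp (p * t)) (Real.exp (p * t) * (p * 1)) t :=
      ((hasDerivAt_id t).const_mul p).exp
    exact (he.hasDerivWithinAt.mul (hy t ht)).congr_deriv (by ring)
  have hmono : MonotoneOn (fun t => Real.exp (p * t) * y t) (Set.Ici 0) :=
    monotoneOn_of_hasDerivWithinAt_nonneg (convex_Ici 0)
      (fun t ht => (hd t ht).continuousWithinAt)
      (fun t ht => (hd t (interior_subset ht)).mono interior_subset)
      (fun t ht => mul_nonneg (Real.exp_pos _).le (hineq t (interior_subset ht)))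
  intro t ht
  have h : Real.exp (p * 0) * y 0 ≤ Real.exp (p * t) * y t := hmono Set.self_mem_Ici ht ht
  rw [mul_zero, Real.exp_zero, one_mul] at h
  exact nonneg_of_mul_nonneg_right (h0.trans h) (Real.exp_pos _)

theorem ContinuousLinearMap.apply_eq_sum_single {ι : Type*} [Fintype ι] [DecidableEq ι]
    (L : (ι → ℝ) →L[ℝ] ℝ) (v : ι → ℝ) : L v = ∑ i, L (Pi.single i 1) * v i := by
  conv_lhs => rw [pi_eq_sum_univ' v, map_sum]
  refine Finset.sum_congr rfl fun i _ => ?_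
  rw [map_smul, smul_eq_mul, mul_comm]

theorem fderiv_fderiv_apply_eq_sum_single {ι : Type*} [Fintype ι] [DecidableEq ι]
    {g : (ι → ℝ) → ℝ} {x : ι → ℝ} (hg : DifferentiableAt ℝ (fderiv ℝ g) x) (v : ι → ℝ) :
    fderiv ℝ (fderiv ℝ g) x v v =
      ∑ i, ∑ j, fderiv ℝ (fun p => fderiv ℝ g p (Pi.single j 1)) x (Pi.single i 1) *
        v i * v j := by
  have hpart : ∀ i j, fderiv ℝ (fun p => fderiv ℝ g p (Pi.single j 1)) x (Pi.single i 1) =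
      fderiv ℝ (fderiv ℝ g) x (Pi.single i 1) (Pi.single j 1) := by
    intro i j
    rw [fderiv_clm_apply hg (differentiableAt_const _)]
    simp
  simp_rw [hpart]
  rw [ContinuousLinearMap.apply_eq_sum_single _ v, Finset.sum_comm]
  refine Finset.sum_congr rfl fun j _ => ?_
  rw [← ContinuousLinearMap.flip_apply, ContinuousLinearMap.apply_eq_sum_single _ v,
    Finset.sum_mul]
  rfl


/-- Task-manifold exponential CBF theorem (relative degree 2): the pullback ECBF
constraint on the configuration acceleration, together with the initial conditions,
guarantees `h₀ (f (σ t)) ≥ 0` along the whole trajectory. -/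
theorem stmt_0 {m n : ℕ}
    (f : (Fin m → ℝ) → (Fin n → ℝ)) (hf : ContDiff ℝ (⊤ : ℕ∞) f)
    (h₀ : (Fin n → ℝ) → ℝ) (hh₀ : ContDiff ℝ (⊤ : ℕ∞) h₀)
    (σ : ℝ → (Fin m → ℝ)) (hσ : ContDiffOn ℝ 2 σ (Set.Ici 0))
    (p₁ p₂ : ℝ) (hp₁ : 0 < p₁) (hp₂ : 0 < p₂)
    (κ₁ κ₂ : ℝ) (hκ₁ : κ₁ = p₁ * p₂) (hκ₂ : κ₂ = p₁ + p₂)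
    (φ : ℝ → ℝ) (hφ : ∀ t, φ t = h₀ (f (σ t)))
    (hconstraint : ∀ t ∈ Set.Ici (0:ℝ),
      (∑ i, fderiv ℝ (h₀ ∘ f) (σ t) (Pi.single i 1) *
          derivWithin (derivWithin σ (Set.Ici 0)) (Set.Ici 0) t i)
        ≥ -(∑ i, ∑ j,
              fderiv ℝ (fun p => fderiv ℝ (h₀ ∘ f) p (Pi.single j 1)) (σ t)
                  (Pi.single i 1) *
                derivWithin σ (Set.Ici 0) t i * derivWithin σ (Set.Ici 0) t j)
          - κ₂ * derivWithin φ (Set.Ici 0) t - κ₁ * φ t)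
    (hinit0 : 0 ≤ φ 0)
    (hinit1 : 0 ≤ derivWithin φ (Set.Ici 0) 0 + p₁ * φ 0) :
    ∀ t ∈ Set.Ici (0:ℝ), 0 ≤ φ t := by
  have hg : ContDiff ℝ 2 (h₀ ∘ f) := contDiff_infty.1 (hh₀.comp hf) 2
  set g := h₀ ∘ f
  set s : Set ℝ := Set.Ici 0
  have hs : UniqueDiffOn ℝ s := uniqueDiffOn_Ici 0
  have hgd : Differentiable ℝ g := hg.differentiable (by norm_num)
  have hgd' : Differentiable ℝ (fderiv ℝ g) :=
    (hg.fderiv_right (m := 1) (by norm_num)).differentiable (by norm_num)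
  have hσ₁ : ∀ t ∈ s, HasDerivWithinAt σ (derivWithin σ s t) s t := fun t ht =>
    ((hσ.differentiableOn (by norm_num)) t ht).hasDerivWithinAt
  have hσ₂ : ∀ t ∈ s,
      HasDerivWithinAt (derivWithin σ s) (derivWithin (derivWithin σ s) s t) s t := fun t ht =>
    (((hσ.derivWithin hs (m := 1) (by norm_num)).differentiableOn (by norm_num)) t
      ht).hasDerivWithinAt
  have hφg : φ = g ∘ σ := funext hφ
  have hφ₁ : ∀ t ∈ s, HasDerivWithinAt φ (fderiv ℝ g (σ t) (derivWithin σ s t)) s t := by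
    intro t ht
    rw [hφg]
    exact (hgd (σ t)).hasFDerivAt.comp_hasDerivWithinAt t (hσ₁ t ht)
  have hφ' : ∀ t ∈ s, derivWithin φ s t = fderiv ℝ g (σ t) (derivWithin σ s t) :=
    fun t ht => (hφ₁ t ht).derivWithin (hs t ht)
  have hφ₂ : ∀ t ∈ s, HasDerivWithinAt (derivWithin φ s)
      (fderiv ℝ (fderiv ℝ g) (σ t) (derivWithin σ s t) (derivWithin σ s t) +
        fderiv ℝ g (σ t) (derivWithin (derivWithin σ s) s t)) s t := by
    intro t ht
    have hD : HasDerivWithinAt (fun t => fderiv ℝ g (σ t))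
        (fderiv ℝ (fderiv ℝ g) (σ t) (derivWithin σ s t)) s t :=
      (hgd' (σ t)).hasFDerivAt.comp_hasDerivWithinAt t (hσ₁ t ht)
    exact (hD.clm_apply (hσ₂ t ht)).congr hφ' (hφ' t ht)
  have hψ : ∀ t ∈ s, 0 ≤ derivWithin φ s t + p₁ * φ t := by
    refine nonneg_of_hasDerivWithinAt_add_mul_nonneg (p := p₂)
      (fun t ht => (hφ₂ t ht).add ((hφ₁ t ht).const_mul p₁)) (fun t ht => ?_) hinit1
    have hc := hconstraint t ht
    rw [← fderiv_fderiv_apply_eq_sum_single (hgd' (σ t)),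
      ← ContinuousLinearMap.apply_eq_sum_single, hκ₁, hκ₂] at hc
    simp only [← hφ' t ht]
    linarith
  exact nonneg_of_hasDerivWithinAt_add_mul_nonneg
    (fun t ht => hφ' t ht ▸ hφ₁ t ht) hψ hinit0
end

section
/- Let φ : [0,∞) → ℝ be twice continuously differentiable, let p₁, p₂ > 0, and set κ₁ = p₁ p₂ and κ₂ = p₁ + p₂. Suppose φ''(t) ≥ −κ₂ φ'(t) − κ₁ φ(t) for all t ≥ 0, and that φ(0) ≥ 0 and φ'(0) + p₁ φ(0) ≥ 0. Then φ(t) ≥ 0 for all t ≥ 0. -/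
open Set in
/-- If `f' + p f ≥ 0` on `[0, ∞)` and `f 0 ≥ 0`, then `f ≥ 0` on `[0, ∞)`. -/
theorem nonneg_of_hasDerivWithinAt_add_mul_nonneg_s1 {f f' : ℝ → ℝ} {p : ℝ}
    (hf : ∀ t ∈ Ici (0 : ℝ), HasDerivWithinAt f (f' t) (Ici 0) t)
    (hf' : ∀ t ∈ Ici (0 : ℝ), 0 ≤ f' t + p * f t) (h0 : 0 ≤ f 0) :
    ∀ t ∈ Ici (0 : ℝ), 0 ≤ f t := by
  have hg : ∀ t ∈ Ici (0 : ℝ), HasDerivWithinAt (fun s => Real.exp (p * s) * f s)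
      (Real.exp (p * t) * (f' t + p * f t)) (Ici 0) t := by
    intro t ht
    have he : HasDerivWithinAt (fun s => Real.exp (p * s)) (Real.exp (p * t) * (p * 1)) (Ici 0) t :=
      ((hasDerivAt_id t).const_mul p).exp.hasDerivWithinAt
    exact (he.mul (hf t ht)).congr_deriv (by ring)
  have hmono : MonotoneOn (fun s => Real.exp (p * s) * f s) (Ici 0) :=
    monotoneOn_of_hasDerivWithinAt_nonneg (convex_Ici 0)
      (fun t ht => (hg t ht).continuousWithinAt)
      (fun t ht => (hg t (interior_subset ht)).mono interior_subset)
      (fun t ht => mul_nonneg (Real.exp_pos _).le (hf' t (interior_subset ht)))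
  intro t ht
  have h := hmono self_mem_Ici ht ht
  simp only [mul_zero, Real.exp_zero, one_mul] at h
  exact nonneg_of_mul_nonneg_right (h0.trans h) (Real.exp_pos _)

/-- Scalar comparison core of the relative-degree-2 ECBF argument: the second-order
differential inequality with pole-placement gains `κ₁ = p₁p₂`, `κ₂ = p₁ + p₂` and the
initial conditions `φ 0 ≥ 0`, `φ' 0 + p₁ φ 0 ≥ 0` imply `φ t ≥ 0` for all `t ≥ 0`. -/
theorem stmt_1 (φ : ℝ → ℝ) (hφ : ContDiffOn ℝ 2 φ (Set.Ici (0:ℝ)))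
    (p₁ p₂ : ℝ) (hp₁ : 0 < p₁) (hp₂ : 0 < p₂)
    (κ₁ κ₂ : ℝ) (hκ₁ : κ₁ = p₁ * p₂) (hκ₂ : κ₂ = p₁ + p₂)
    (hineq : ∀ t ∈ Set.Ici (0:ℝ),
      derivWithin (derivWithin φ (Set.Ici 0)) (Set.Ici 0) t
        ≥ -κ₂ * derivWithin φ (Set.Ici 0) t - κ₁ * φ t)
    (hinit0 : 0 ≤ φ 0)
    (hinit1 : 0 ≤ derivWithin φ (Set.Ici 0) 0 + p₁ * φ 0) :
    ∀ t ∈ Set.Ici (0:ℝ), 0 ≤ φ t := by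
  have hd : DifferentiableOn ℝ φ (Set.Ici 0) := hφ.differentiableOn (by norm_num)
  have hd' : DifferentiableOn ℝ (derivWithin φ (Set.Ici 0)) (Set.Ici 0) :=
    (hφ.derivWithin (m := 1) (uniqueDiffOn_Ici 0) (by norm_num)).differentiableOn (by norm_num)
  refine nonneg_of_hasDerivWithinAt_add_mul_nonneg_s1 (fun t ht => (hd t ht).hasDerivWithinAt)
    (p := p₁) ?_ hinit0
  refine nonneg_of_hasDerivWithinAt_add_mul_nonneg_s1 (p := p₂) (fun t ht =>
    (hd' t ht).hasDerivWithinAt.add ((hd t ht).hasDerivWithinAt.const_mul p₁)) ?_ hinit1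
  intro t ht
  have h := hineq t ht
  subst hκ₁ hκ₂
  linarith
end

section
/- Let φ : [0,∞) → ℝ be twice continuously differentiable and let p₁, p₂ > 0 with p₁ ≠ p₂. Suppose φ''(t) ≥ −(p₁+p₂) φ'(t) − p₁ p₂ φ(t) for all t ≥ 0. Then for all t ≥ 0, φ(t) ≥ ((p₂ e^{−p₁ t} − p₁ e^{−p₂ t})/(p₂ − p₁)) · φ(0) + ((e^{−p₁ t} − e^{−p₂ t})/(p₂ − p₁)) · φ'(0). -/
/-- Grönwall-type lower bound: if `y' ≥ -p y` on `[0, ∞)`, then `y t ≥ exp (-p t) y 0`. -/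
theorem exp_neg_mul_le_of_hasDerivWithinAt {y y' : ℝ → ℝ} {p : ℝ}
    (hy : ∀ t ∈ Set.Ici (0:ℝ), HasDerivWithinAt y (y' t) (Set.Ici 0) t)
    (h : ∀ t ∈ Set.Ici (0:ℝ), 0 ≤ y' t + p * y t) {t : ℝ} (ht : 0 ≤ t) :
    Real.exp (-p * t) * y 0 ≤ y t := by
  have hd : ∀ s ∈ Set.Ici (0:ℝ), HasDerivWithinAt (fun s => Real.exp (p * s) * y s)
      (Real.exp (p * s) * (y' s + p * y s)) (Set.Ici 0) s := fun s hs => by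
    have he := (((hasDerivAt_id s).const_mul p).exp).hasDerivWithinAt (s := Set.Ici (0:ℝ))
    refine (he.mul (hy s hs)).congr_deriv ?_
    simp only [id]
    ring
  have hmono : MonotoneOn (fun s => Real.exp (p * s) * y s) (Set.Ici 0) :=
    monotoneOn_of_hasDerivWithinAt_nonneg (convex_Ici 0)
      (fun s hs => (hd s hs).continuousWithinAt)
      (fun s hs => (hd s (interior_subset hs)).mono interior_subset)
      (fun s hs => mul_nonneg (Real.exp_pos _).le (h s (interior_subset hs)))
  have h0 : y 0 ≤ Real.exp (p * t) * y t := by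
    simpa using hmono Set.self_mem_Ici ht ht
  calc Real.exp (-p * t) * y 0
      ≤ Real.exp (-p * t) * (Real.exp (p * t) * y t) := by gcongr
    _ = y t := by rw [← mul_assoc, ← Real.exp_add]; simp

/-- Explicit exponential comparison lower bound for the relative-degree-2 ECBF with
distinct negative real poles `−p₁`, `−p₂`. -/
theorem stmt_2 (φ : ℝ → ℝ) (hφ : ContDiffOn ℝ 2 φ (Set.Ici (0:ℝ)))
    (p₁ p₂ : ℝ) (hp₁ : 0 < p₁) (hp₂ : 0 < p₂) (hne : p₁ ≠ p₂)
    (hineq : ∀ t ∈ Set.Ici (0:ℝ),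
      derivWithin (derivWithin φ (Set.Ici 0)) (Set.Ici 0) t
        ≥ -(p₁ + p₂) * derivWithin φ (Set.Ici 0) t - (p₁ * p₂) * φ t) :
    ∀ t ∈ Set.Ici (0:ℝ),
      ((p₂ * Real.exp (-p₁ * t) - p₁ * Real.exp (-p₂ * t)) / (p₂ - p₁)) * φ 0
          + ((Real.exp (-p₁ * t) - Real.exp (-p₂ * t)) / (p₂ - p₁))
              * derivWithin φ (Set.Ici 0) 0
        ≤ φ t := by
  intro t ht
  have hu : UniqueDiffOn ℝ (Set.Ici (0:ℝ)) := uniqueDiffOn_Ici 0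
  have hd1 : ∀ s ∈ Set.Ici (0:ℝ),
      HasDerivWithinAt φ (derivWithin φ (Set.Ici 0) s) (Set.Ici 0) s :=
    fun s hs => (hφ.differentiableOn (by norm_num) s hs).hasDerivWithinAt
  have hφ' : ContDiffOn ℝ 1 (derivWithin φ (Set.Ici 0)) (Set.Ici (0:ℝ)) :=
    hφ.derivWithin hu (by norm_num)
  have hd2 : ∀ s ∈ Set.Ici (0:ℝ), HasDerivWithinAt (derivWithin φ (Set.Ici 0))
      (derivWithin (derivWithin φ (Set.Ici 0)) (Set.Ici 0) s) (Set.Ici 0) s :=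
    fun s hs => (hφ'.differentiableOn (by norm_num) s hs).hasDerivWithinAt
  have hy : ∀ s ∈ Set.Ici (0:ℝ),
      Real.exp (-p₂ * s) * (derivWithin φ (Set.Ici 0) 0 + p₁ * φ 0)
        ≤ derivWithin φ (Set.Ici 0) s + p₁ * φ s := fun s hs =>
    exp_neg_mul_le_of_hasDerivWithinAt
      (y := fun s => derivWithin φ (Set.Ici 0) s + p₁ * φ s)
      (fun r hr => (hd2 r hr).add ((hd1 r hr).const_mul p₁))
      (fun r hr => by linarith [hineq r hr]) hs
  set c := (derivWithin φ (Set.Ici 0) 0 + p₁ * φ 0) / (p₁ - p₂)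
  have hsub : p₁ - p₂ ≠ 0 := sub_ne_zero.mpr hne
  have hcy : c * (p₁ - p₂) = derivWithin φ (Set.Ici 0) 0 + p₁ * φ 0 :=
    div_mul_cancel₀ _ hsub
  have hz := exp_neg_mul_le_of_hasDerivWithinAt (p := p₁)
    (y := fun s => φ s - c * Real.exp (-p₂ * s))
    (fun r hr => (hd1 r hr).sub
      ((((hasDerivAt_id r).const_mul (-p₂)).exp).hasDerivWithinAt.const_mul c))
    (fun r hr => by
      have := hy r hr
      rw [← hcy] at this
      simp only [id]
      linarith) ht
  simp only [mul_zero, Real.exp_zero, mul_one] at hz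
  have hsub' : p₂ - p₁ ≠ 0 := sub_ne_zero.mpr hne.symm
  have key : ((p₂ * Real.exp (-p₁ * t) - p₁ * Real.exp (-p₂ * t)) / (p₂ - p₁)) * φ 0
      + ((Real.exp (-p₁ * t) - Real.exp (-p₂ * t)) / (p₂ - p₁)) * derivWithin φ (Set.Ici 0) 0
      = Real.exp (-p₁ * t) * (φ 0 - c) + c * Real.exp (-p₂ * t) := by
    rw [eq_sub_of_add_eq hcy.symm]
    field_simp
    ring
  linarith
end

section
/- Let φ : [0,∞) → ℝ be twice continuously differentiable, let p₁, p₂ > 0, and suppose φ''(t) ≥ −(p₁+p₂) φ'(t) − p₁ p₂ φ(t) for all t ≥ 0, with arbitrary (possibly negative) initial values φ(0) and φ'(0). Then liminf_{t→∞} φ(t) ≥ 0. -/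
open Set Filter Topology in
/-- If `f' + p f` has nonnegative lower limit at infinity and `p > 0`, then so does `f`. -/
theorem eventually_neg_le_of_deriv_add_mul {f f' : ℝ → ℝ} {p : ℝ} (hp : 0 < p)
    (hf : ∀ t, 0 < t → HasDerivAt f (f' t) t)
    (h : ∀ ε > 0, ∀ᶠ t in atTop, -ε ≤ f' t + p * f t) :
    ∀ ε > 0, ∀ᶠ t in atTop, -ε ≤ f t := by
  intro ε hε
  obtain ⟨T, hT⟩ := eventually_atTop.1 ((h (p * (ε / 2)) (by positivity)).and (eventually_gt_atTop 0))
  have hd : ∀ t ∈ Ici T, HasDerivAt (fun s => (f s + ε / 2) * Real.exp (p * s))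
      ((f' t + p * f t + p * (ε / 2)) * Real.exp (p * t)) t := by
    intro t ht
    have h₁ : HasDerivAt (fun s => Real.exp (p * s)) (Real.exp (p * t) * (p * 1)) t :=
      ((hasDerivAt_id t).const_mul p).exp
    refine (((hf t (hT t ht).2).add_const (ε / 2)).mul h₁).congr_deriv ?_
    ring
  have hmono : MonotoneOn (fun s => (f s + ε / 2) * Real.exp (p * s)) (Ici T) := by
    refine monotoneOn_of_deriv_nonneg (convex_Ici T)
      (fun t ht => (hd t ht).continuousAt.continuousWithinAt)
      (fun t ht => (hd t (interior_subset ht)).differentiableAt.differentiableWithinAt)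
      (fun t ht => ?_)
    rw [(hd t (interior_subset ht)).deriv]
    have := (hT t (interior_subset ht)).1
    exact mul_nonneg (by linarith) (Real.exp_pos _).le
  set C := (f T + ε / 2) * Real.exp (p * T) with hC
  have hlim : Tendsto (fun t => C * Real.exp (-(p * t))) atTop (𝓝 0) := by
    simpa using (Real.tendsto_exp_neg_atTop_nhds_zero.comp
      (tendsto_id.const_mul_atTop hp)).const_mul C
  filter_upwards [hlim.eventually (lt_mem_nhds (show -(ε / 2) < 0 by linarith)),
    eventually_ge_atTop T] with t ht htT
  have h₂ : C ≤ (f t + ε / 2) * Real.exp (p * t) := hmono self_mem_Ici htT htT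
  have h₃ : C * Real.exp (-(p * t)) ≤ f t + ε / 2 := by
    rwa [Real.exp_neg, ← div_eq_mul_inv, div_le_iff₀ (Real.exp_pos _)]
  linarith

/-- A real function eventually above every negative number has nonnegative `liminf`; this includes
the unbounded case, where the `liminf` takes its default value `0`. -/
theorem liminf_nonneg_of_eventually_neg_le {f : ℝ → ℝ}
    (h : ∀ ε > 0, ∀ᶠ t in Filter.atTop, -ε ≤ f t) : 0 ≤ Filter.liminf f Filter.atTop := by
  rw [Filter.liminf_eq]
  by_cases hb : BddAbove {a | ∀ᶠ t in Filter.atTop, a ≤ f t}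
  · refine le_of_forall_pos_le_add fun ε hε => ?_
    linarith [le_csSup hb (h ε hε)]
  · rw [Real.sSup_of_not_bddAbove hb]


/-- Recovery property of the relative-degree-2 ECBF with negative real poles: from
arbitrary (possibly unsafe) initial conditions, `liminf_{t→∞} φ(t) ≥ 0`. -/
theorem stmt_5 (φ : ℝ → ℝ) (hφ : ContDiffOn ℝ 2 φ (Set.Ici (0:ℝ)))
    (p₁ p₂ : ℝ) (hp₁ : 0 < p₁) (hp₂ : 0 < p₂)
    (hineq : ∀ t ∈ Set.Ici (0:ℝ),
      derivWithin (derivWithin φ (Set.Ici 0)) (Set.Ici 0) t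
        ≥ -(p₁ + p₂) * derivWithin φ (Set.Ici 0) t - (p₁ * p₂) * φ t) :
    0 ≤ Filter.liminf φ Filter.atTop := by
  have hφ' : ContDiffOn ℝ 1 (derivWithin φ (Set.Ici 0)) (Set.Ici 0) :=
    hφ.derivWithin (uniqueDiffOn_Ici 0) (by norm_num)
  have hd : ∀ t, 0 < t → HasDerivAt φ (derivWithin φ (Set.Ici 0) t) t := fun t ht =>
    ((hφ.differentiableOn (by norm_num)) t ht.le).hasDerivWithinAt.hasDerivAt (Ici_mem_nhds ht)
  have hd' : ∀ t, 0 < t → HasDerivAt (derivWithin φ (Set.Ici 0))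
      (derivWithin (derivWithin φ (Set.Ici 0)) (Set.Ici 0) t) t := fun t ht =>
    ((hφ'.differentiableOn (by norm_num)) t ht.le).hasDerivWithinAt.hasDerivAt (Ici_mem_nhds ht)
  refine liminf_nonneg_of_eventually_neg_le (eventually_neg_le_of_deriv_add_mul hp₁ hd ?_)
  refine eventually_neg_le_of_deriv_add_mul hp₂
    (fun t ht => (hd' t ht).add ((hd t ht).const_mul p₁)) fun ε hε => ?_
  filter_upwards [Filter.eventually_ge_atTop 0] with t ht
  linarith [hineq t ht]
end

section
/- Let U ⊆ ℝ^n be open, let g : U → ℝ^{n×n} be smooth with g(x) symmetric positive definite for every x ∈ U, and define the Christoffel symbols Γ^k_{ij}(x) = (1/2) Σ_l (g(x)⁻¹)_{kl} (∂_i g_{jl}(x) + ∂_j g_{il}(x) − ∂_l g_{ij}(x)). Let h₀ : U → ℝ and ξ̃ : U → ℝ^n be smooth, let ε ∈ ℝ, and let x : ℝ → U be twice continuously differentiable. Define e(t) = x'(t) − ξ̃(x(t)) and h(t) = h₀(x(t)) − (ε/2) e(t)ᵀ g(x(t)) e(t). Then for all t: h'(t) = ∇h₀(x(t))·x'(t)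 + ε e(t)ᵀ g(x(t)) (W(t) − A(t)), where W(t) ∈ ℝ^n has components W^α = Σ_γ (∂ξ̃^α/∂x^γ)(x(t)) x'^γ(t) + Σ_{γ,δ} Γ^α_{γδ}(x(t)) x'^γ(t) ξ̃^δ(x(t)) (the covariant derivative of ξ̃ along x') and A(t) ∈ ℝ^n has components A^α = x''^α(t) + Σ_{γ,δ} Γ^α_{γδ}(x(t)) x'^γ(t) x'^δ(t) (the covariant acceleration of x). -/
open scoped Matrix

/-- Chain rule along a curve, in coordinates. -/
lemma hasDerivAt_comp_curve {n : ℕ} {f : (Fin n → ℝ) → ℝ} {x : ℝ → Fin n → ℝ}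
    {v : Fin n → ℝ} {t : ℝ} (hf : DifferentiableAt ℝ f (x t)) (hx : HasDerivAt x v t) :
    HasDerivAt (fun s => f (x s)) (∑ γ, fderiv ℝ f (x t) (Pi.single γ 1) * v γ) t := by
  have h := hf.hasFDerivAt.comp_hasDerivAt t hx
  have hv : fderiv ℝ f (x t) v = ∑ γ, fderiv ℝ f (x t) (Pi.single γ 1) * v γ := by
    conv_lhs => rw [pi_eq_sum_univ' v, map_sum]
    refine Finset.sum_congr rfl fun γ _ => ?_
    rw [map_smul, smul_eq_mul, mul_comm]
  exact hv ▸ h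

/-- Product rule for a quadratic form with symmetric, time-dependent matrix. -/
lemma hasDerivAt_dotProduct_mulVec {n : ℕ} {G : ℝ → Matrix (Fin n) (Fin n) ℝ}
    {G' : Matrix (Fin n) (Fin n) ℝ} {e : ℝ → Fin n → ℝ} {e' : Fin n → ℝ} {t : ℝ}
    (hG : ∀ i j, HasDerivAt (fun s => G s i j) (G' i j) t)
    (he : ∀ i, HasDerivAt (fun s => e s i) (e' i) t) (hsymm : (G t).IsSymm) :
    HasDerivAt (fun s => e s ⬝ᵥ (G s *ᵥ e s))
      (2 * (e t ⬝ᵥ (G t *ᵥ e')) + e t ⬝ᵥ (G' *ᵥ e t)) t := by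
  have hmul (i) : HasDerivAt (fun s => (G s *ᵥ e s) i)
      (∑ j, (G' i j * e t j + G t i j * e' j)) t := by
    simp only [Matrix.mulVec, dotProduct]
    exact HasDerivAt.fun_sum fun j _ => (hG i j).fun_mul (he j)
  have h : HasDerivAt (fun s => e s ⬝ᵥ (G s *ᵥ e s))
      (∑ i, (e' i * (G t *ᵥ e t) i + e t i * ∑ j, (G' i j * e t j + G t i j * e' j))) t := by
    simp only [dotProduct]
    exact HasDerivAt.fun_sum fun i _ => (he i).fun_mul (hmul i)
  convert h using 1
  have hs : e t ⬝ᵥ (G t *ᵥ e') = e' ⬝ᵥ (G t *ᵥ e t) := by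
    rw [Matrix.dotProduct_mulVec, ← Matrix.mulVec_transpose, hsymm.eq, dotProduct_comm]
  calc 2 * (e t ⬝ᵥ (G t *ᵥ e')) + e t ⬝ᵥ (G' *ᵥ e t)
      = e' ⬝ᵥ (G t *ᵥ e t) + (e t ⬝ᵥ (G' *ᵥ e t) + e t ⬝ᵥ (G t *ᵥ e')) := by
        rw [← hs]; ring
    _ = _ := by
        simp only [dotProduct, Matrix.mulVec, Finset.sum_add_distrib, mul_add]

/-- Metric compatibility: contracting the Christoffel symbols built from the partial derivatives
`D i j k = ∂ₖ gᵢⱼ` twice with `e` and once with `v` gives half the derivative of `g(e, e)`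
along `v`. -/
lemma dotProduct_mulVec_christoffel {n : ℕ} {G : Matrix (Fin n) (Fin n) ℝ}
    (hG : IsUnit G.det) (D : Fin n → Fin n → Fin n → ℝ) (v e : Fin n → ℝ) :
    e ⬝ᵥ (G *ᵥ fun α => ∑ γ, ∑ δ,
        ((1 / 2) * ∑ l, G⁻¹ α l * (D δ l γ + D γ l δ - D γ δ l)) * v γ * e δ) =
      (1 / 2) * (e ⬝ᵥ ((Matrix.of fun i j => ∑ γ, D i j γ * v γ) *ᵥ e)) := by
  have hraise : (fun α => ∑ γ, ∑ δ,
        ((1 / 2) * ∑ l, G⁻¹ α l * (D δ l γ + D γ l δ - D γ δ l)) * v γ * e δ) =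
      G⁻¹ *ᵥ fun l => ∑ γ, ∑ δ, (1 / 2) * (D δ l γ + D γ l δ - D γ δ l) * v γ * e δ := by
    ext α
    simp only [Matrix.mulVec, dotProduct, Finset.mul_sum, Finset.sum_mul]
    rw [Finset.sum_comm_cycle]
    refine Finset.sum_congr rfl fun _ _ => Finset.sum_congr rfl fun _ _ =>
      Finset.sum_congr rfl fun _ _ => ?_
    ring
  rw [hraise, Matrix.mulVec_mulVec, Matrix.mul_nonsing_inv _ hG, Matrix.one_mulVec]
  have hanti : ∑ l, ∑ δ, ∑ γ, e l * (D γ l δ * v γ * e δ) =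
      ∑ l, ∑ δ, ∑ γ, e l * (D γ δ l * v γ * e δ) := by
    rw [Finset.sum_comm]
    refine Finset.sum_congr rfl fun _ _ => Finset.sum_congr rfl fun _ _ =>
      Finset.sum_congr rfl fun _ _ => ?_
    ring
  have hmain : ∑ l, ∑ δ, ∑ γ, e l * (D δ l γ * v γ * e δ) =
      e ⬝ᵥ ((Matrix.of fun i j => ∑ γ, D i j γ * v γ) *ᵥ e) := by
    simp only [Matrix.mulVec, dotProduct, Matrix.of_apply, Finset.mul_sum, Finset.sum_mul]
    rw [Finset.sum_comm]
    refine Finset.sum_congr rfl fun _ _ => Finset.sum_congr rfl fun _ _ =>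
      Finset.sum_congr rfl fun _ _ => ?_
    ring
  rw [← hmain]
  calc e ⬝ᵥ (fun l => ∑ γ, ∑ δ, (1 / 2) * (D δ l γ + D γ l δ - D γ δ l) * v γ * e δ)
      = ∑ l, ∑ δ, ∑ γ, (1 / 2) * (e l * (D δ l γ * v γ * e δ) +
          e l * (D γ l δ * v γ * e δ) - e l * (D γ δ l * v γ * e δ)) := by
        simp only [dotProduct, Finset.mul_sum]
        refine Finset.sum_congr rfl fun _ _ => ?_
        rw [Finset.sum_comm]
        refine Finset.sum_congr rfl fun _ _ => Finset.sum_congr rfl fun _ _ => ?_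
        ring
    _ = _ := by
        simp only [← Finset.mul_sum, Finset.sum_add_distrib, Finset.sum_sub_distrib] at hanti ⊢
        rw [hanti, add_sub_cancel_right]

/-- Coordinate form of the time derivative of the backstepping CBF candidate
`h(t) = h₀(x t) − (ε/2)‖ẋ − ξ̃(x)‖²_g`: after the metric-compatibility cancellation,
`h' = ∇h₀·ẋ + ε ⟨e, ∇_{ẋ}ξ̃ − covariant acceleration⟩_g`. -/
theorem stmt_8 {n : ℕ} (U : Set (Fin n → ℝ)) (hU : IsOpen U)
    (g : (Fin n → ℝ) → Matrix (Fin n) (Fin n) ℝ)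
    (hg : ∀ i j, ContDiffOn ℝ (⊤ : ℕ∞) (fun y => g y i j) U)
    (hgpd : ∀ y ∈ U, (g y).PosDef)
    (Γ : (Fin n → ℝ) → Fin n → Fin n → Fin n → ℝ)
    (hΓ : ∀ y k i j, Γ y k i j = (1/2) * ∑ l, (g y)⁻¹ k l *
        (fderiv ℝ (fun z => g z j l) y (Pi.single i 1)
          + fderiv ℝ (fun z => g z i l) y (Pi.single j 1)
          - fderiv ℝ (fun z => g z i j) y (Pi.single l 1)))
    (h₀ : (Fin n → ℝ) → ℝ) (hh₀ : ContDiffOn ℝ (⊤ : ℕ∞) h₀ U)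
    (ξ : (Fin n → ℝ) → (Fin n → ℝ)) (hξ : ContDiffOn ℝ (⊤ : ℕ∞) ξ U)
    (ε : ℝ)
    (x : ℝ → (Fin n → ℝ)) (hx : ContDiff ℝ 2 x) (hxU : ∀ t, x t ∈ U)
    (e : ℝ → (Fin n → ℝ)) (he : ∀ t, e t = deriv x t - ξ (x t))
    (h : ℝ → ℝ) (hh : ∀ t, h t = h₀ (x t) - (ε / 2) * (e t ⬝ᵥ (g (x t) *ᵥ e t)))
    (W : ℝ → (Fin n → ℝ))
    (hW : ∀ t α, W t α =
        (∑ γ, fderiv ℝ (fun y => ξ y α) (x t) (Pi.single γ 1) * deriv x t γ)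
          + ∑ γ, ∑ δ, Γ (x t) α γ δ * deriv x t γ * ξ (x t) δ)
    (A : ℝ → (Fin n → ℝ))
    (hA : ∀ t α, A t α =
        deriv (deriv x) t α + ∑ γ, ∑ δ, Γ (x t) α γ δ * deriv x t γ * deriv x t δ) :
    ∀ t, deriv h t =
        (∑ γ, fderiv ℝ h₀ (x t) (Pi.single γ 1) * deriv x t γ)
          + ε * (e t ⬝ᵥ (g (x t) *ᵥ (W t - A t))) := by
  intro t
  have hnhds : U ∈ nhds (x t) := hU.mem_nhds (hxU t)
  have hgd (i j) : DifferentiableAt ℝ (fun y => g y i j) (x t) :=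
    ((hg i j).contDiffAt hnhds).differentiableAt (by simp)
  have hh₀d : DifferentiableAt ℝ h₀ (x t) := (hh₀.contDiffAt hnhds).differentiableAt (by simp)
  have hξd : DifferentiableAt ℝ ξ (x t) := (hξ.contDiffAt hnhds).differentiableAt (by simp)
  have hx1 : HasDerivAt x (deriv x t) t := (hx.differentiable (by simp) t).hasDerivAt
  have hx2 : HasDerivAt (deriv x) (deriv (deriv x) t) t :=
    (((contDiff_succ_iff_deriv (n := 1)).1 hx).2.2.differentiable (by simp) t).hasDerivAt
  have hed (i) : HasDerivAt (fun s => e s i) (deriv (deriv x) t i -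
      ∑ γ, fderiv ℝ (fun y => ξ y i) (x t) (Pi.single γ 1) * deriv x t γ) t := by
    simp only [he, Pi.sub_apply]
    exact (hasDerivAt_pi.1 hx2 i).fun_sub
      (hasDerivAt_comp_curve (f := fun y => ξ y i) (differentiableAt_pi.1 hξd i) hx1)
  have hquad := hasDerivAt_dotProduct_mulVec (G := fun s => g (x s))
    (G' := Matrix.of fun i j =>
      ∑ γ, fderiv ℝ (fun y => g y i j) (x t) (Pi.single γ 1) * deriv x t γ)
    (fun i j => hasDerivAt_comp_curve (hgd i j) hx1) hed
    (Matrix.isHermitian_iff_isSymm.1 (hgpd _ (hxU t)).isHermitian)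
  have hcompat := dotProduct_mulVec_christoffel
    (hgpd _ (hxU t)).det_pos.ne'.isUnit
    (fun i j γ => fderiv ℝ (fun y => g y i j) (x t) (Pi.single γ 1)) (deriv x t) (e t)
  have hWA : W t - A t = -(fun i => deriv (deriv x) t i -
      ∑ γ, fderiv ℝ (fun y => ξ y i) (x t) (Pi.single γ 1) * deriv x t γ) -
      fun α => ∑ γ, ∑ δ, Γ (x t) α γ δ * deriv x t γ * e t δ := by
    ext α
    simp only [Pi.sub_apply, Pi.neg_apply, hW, hA, he, mul_sub, Finset.sum_sub_distrib]
    ring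
  simp only [← hΓ] at hcompat
  rw [funext hh, ((hasDerivAt_comp_curve hh₀d hx1).fun_sub (hquad.const_mul (ε / 2))).deriv, hWA,
    Matrix.mulVec_sub, Matrix.mulVec_neg, dotProduct_sub, dotProduct_neg, hcompat]
  ring
end

section
/- Let U ⊆ ℝ^n be open, let g : U → ℝ^{n×n} be smooth with g(x) symmetric positive definite for every x ∈ U, and define the Christoffel symbols Γ^k_{ij}(x) = (1/2) Σ_l (g(x)⁻¹)_{kl} (∂_i g_{jl}(x) + ∂_j g_{il}(x) − ∂_l g_{ij}(x)). Let h₀ : U → ℝ and ξ̃ : U → ℝ^n be smooth, let ε > 0, let α : ℝ → ℝ, and let f : ℝ^m → U be smooth. Fix a state (σ, σ̇) ∈ ℝ^m × ℝ^m, set x = f(σ), ẋ = Jf(σ)σ̇ (where Jf is the Jacobian of f), e = ẋ − ξ̃(x), and h = h₀(x) − (ε/2) eᵀ g(x) e, and assume Jf(σ) has full row rank n. For a candidate acceleration a ∈ ℝ^m define D(a) = ∇h₀(x)·ẋ + ε eᵀ g(x) (W − (Jf(σ)a + H + Q)), where W^α = Σ_γ (∂ξ̃^α/∂x^γ)(x)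 ẋ^γ + Σ_{γ,δ} Γ^α_{γδ}(x) ẋ^γ ξ̃^δ(x), H^α = Σ_{i,j} (∂²f^α/∂σ^i∂σ^j)(σ) σ̇^i σ̇^j, and Q^α = Σ_{γ,δ} Γ^α_{γδ}(x) ẋ^γ ẋ^δ. Then: (i) if e ≠ 0, then for every M ∈ ℝ there exists a ∈ ℝ^m with D(a) > M (the supremum of D over ℝ^m is +∞); and (ii) if e = 0 and ∇h₀(x)·ξ̃(x) > −α(h₀(x)), then D(a) = ∇h₀(x)·ξ̃(x) > −α(h) for every a ∈ ℝ^m. In both cases sup_{a ∈ ℝ^m} D(a) > −α(h). -/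
open scoped Matrix

/-- A real matrix of full row rank acts surjectively on column vectors. -/
theorem Matrix.mulVec_surjective_of_rank_eq {n m : ℕ} {J : Matrix (Fin n) (Fin m) ℝ}
    (hJ : J.rank = n) : Function.Surjective (J *ᵥ ·) := by
  have hr : LinearMap.range J.mulVecLin = ⊤ :=
    Submodule.eq_top_of_finrank_eq (by simpa [Matrix.rank] using hJ)
  exact LinearMap.range_eq_top.mp hr

/-- If `G` is positive definite, `J` has full row rank and `e ≠ 0`, then the affine function
`a ↦ c + ε eᵀ G (w - (J a + u + v))` is unbounded above. -/
theorem Matrix.PosDef.exists_lt_affine {n m : ℕ} {G : Matrix (Fin n) (Fin n) ℝ}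
    (hG : G.PosDef) {J : Matrix (Fin n) (Fin m) ℝ} (hJ : J.rank = n) {ε : ℝ} (hε : 0 < ε)
    {e : Fin n → ℝ} (he : e ≠ 0) (c : ℝ) (w u v : Fin n → ℝ) (M : ℝ) :
    ∃ a : Fin m → ℝ, M < c + ε * (e ⬝ᵥ (G *ᵥ (w - (J *ᵥ a + u + v)))) := by
  have hpos : 0 < e ⬝ᵥ (G *ᵥ e) := by simpa using hG.dotProduct_mulVec_pos he
  set q := e ⬝ᵥ (G *ᵥ e) with hq
  obtain ⟨b, hb⟩ := Matrix.mulVec_surjective_of_rank_eq hJ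
    (w - u - v - ((M + 1 - c) / (ε * q)) • e)
  refine ⟨b, ?_⟩
  have hvec : w - (J *ᵥ b + u + v) = ((M + 1 - c) / (ε * q)) • e := by
    rw [show J *ᵥ b = _ from hb]
    abel
  have hval : ε * ((M + 1 - c) / (ε * q) * q) = M + 1 - c := by
    field_simp
  rw [hvec, Matrix.mulVec_smul, dotProduct_smul, smul_eq_mul, ← hq, hval]
  linarith

/-- Task-manifold backstepping CBF theorem: at a fixed state `(σ₀, σ̇₀)` with full-row-rank
task Jacobian, the affine barrier-derivative expression `D(a)` in the configuration
acceleration `a` is unbounded above when the velocity error `e ≠ 0`, reduces to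
`∇h₀·ξ̃ > −α(h)` when `e = 0` and the strict first-order CBF condition holds, and in
both cases `sup_a D(a) > −α(h)`. -/
theorem stmt_9 {n m : ℕ} (U : Set (Fin n → ℝ)) (hU : IsOpen U)
    (g : (Fin n → ℝ) → Matrix (Fin n) (Fin n) ℝ)
    (hg : ∀ i j, ContDiffOn ℝ (⊤ : ℕ∞) (fun y => g y i j) U)
    (hgpd : ∀ y ∈ U, (g y).PosDef)
    (Γ : (Fin n → ℝ) → Fin n → Fin n → Fin n → ℝ)
    (hΓ : ∀ y k i j, Γ y k i j = (1/2) * ∑ l, (g y)⁻¹ k l *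
        (fderiv ℝ (fun z => g z j l) y (Pi.single i 1)
          + fderiv ℝ (fun z => g z i l) y (Pi.single j 1)
          - fderiv ℝ (fun z => g z i j) y (Pi.single l 1)))
    (h₀ : (Fin n → ℝ) → ℝ) (hh₀ : ContDiffOn ℝ (⊤ : ℕ∞) h₀ U)
    (ξ : (Fin n → ℝ) → (Fin n → ℝ)) (hξ : ContDiffOn ℝ (⊤ : ℕ∞) ξ U)
    (ε : ℝ) (hε : 0 < ε) (α : ℝ → ℝ)
    (f : (Fin m → ℝ) → (Fin n → ℝ)) (hf : ContDiff ℝ (⊤ : ℕ∞) f) (hfU : ∀ p, f p ∈ U)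
    (σ₀ σdot : Fin m → ℝ)
    (x : Fin n → ℝ) (hx : x = f σ₀)
    (J : Matrix (Fin n) (Fin m) ℝ)
    (hJ : ∀ (a : Fin n) (k : Fin m), J a k = fderiv ℝ f σ₀ (Pi.single k 1) a)
    (hrank : J.rank = n)
    (xdot : Fin n → ℝ) (hxdot : xdot = J *ᵥ σdot)
    (e : Fin n → ℝ) (he : e = xdot - ξ x)
    (h : ℝ) (hhdef : h = h₀ x - (ε / 2) * (e ⬝ᵥ (g x *ᵥ e)))
    (W : Fin n → ℝ)
    (hW : ∀ a, W a =
        (∑ γ, fderiv ℝ (fun y => ξ y a) x (Pi.single γ 1) * xdot γ)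
          + ∑ γ, ∑ δ, Γ x a γ δ * xdot γ * ξ x δ)
    (H : Fin n → ℝ)
    (hH : ∀ a, H a = ∑ i, ∑ j,
        fderiv ℝ (fun p => fderiv ℝ f p (Pi.single j 1) a) σ₀ (Pi.single i 1)
          * σdot i * σdot j)
    (Q : Fin n → ℝ)
    (hQ : ∀ a, Q a = ∑ γ, ∑ δ, Γ x a γ δ * xdot γ * xdot δ)
    (D : (Fin m → ℝ) → ℝ)
    (hD : ∀ a, D a =
        (∑ γ, fderiv ℝ h₀ x (Pi.single γ 1) * xdot γ)
          + ε * (e ⬝ᵥ (g x *ᵥ (W - (J *ᵥ a + H + Q))))) :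
    (e ≠ 0 → ∀ M : ℝ, ∃ a : Fin m → ℝ, M < D a) ∧
      (e = 0 →
        (∑ γ, fderiv ℝ h₀ x (Pi.single γ 1) * ξ x γ) > -α (h₀ x) →
        ∀ a : Fin m → ℝ,
          D a = (∑ γ, fderiv ℝ h₀ x (Pi.single γ 1) * ξ x γ) ∧ D a > -α h) ∧
      ((e ≠ 0 ∨ (e = 0 ∧ (∑ γ, fderiv ℝ h₀ x (Pi.single γ 1) * ξ x γ) > -α (h₀ x))) →
        ∃ a : Fin m → ℝ, -α h < D a) := by
  have hunbounded : e ≠ 0 → ∀ M : ℝ, ∃ a : Fin m → ℝ, M < D a := by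
    intro hne M
    simp only [hD]
    exact (hgpd x (hx ▸ hfU σ₀)).exists_lt_affine hrank hε hne _ W H Q M
  have hzero : e = 0 →
      (∑ γ, fderiv ℝ h₀ x (Pi.single γ 1) * ξ x γ) > -α (h₀ x) →
      ∀ a : Fin m → ℝ,
        D a = (∑ γ, fderiv ℝ h₀ x (Pi.single γ 1) * ξ x γ) ∧ D a > -α h := by
    intro h0 hcbf a
    have hv : xdot = ξ x := sub_eq_zero.mp (he.symm.trans h0)
    have hh : h = h₀ x := by simp [hhdef, h0]
    have hDa : D a = ∑ γ, fderiv ℝ h₀ x (Pi.single γ 1) * ξ x γ := by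
      simp [hD, h0, hv]
    exact ⟨hDa, by rw [hDa, hh]; exact hcbf⟩
  refine ⟨hunbounded, hzero, ?_⟩
  rintro (hne | ⟨h0, hcbf⟩)
  · exact hunbounded hne _
  · exact ⟨0, (hzero h0 hcbf 0).2⟩
end

section
/- Let α : ℝ → ℝ be continuous, strictly increasing, and satisfy α(0) = 0. Let h : [0,∞) → ℝ be differentiable with h'(t) ≥ −α(h(t)) for all t ≥ 0, with arbitrary (possibly negative) initial value h(0). Then: (i) h(t) ≥ min(h(0), 0) for all t ≥ 0; and (ii) liminf_{t→∞} h(t) ≥ 0. -/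
/-- A function on `[0, ∞)` whose derivative exceeds `m` wherever its graph meets a line of slope `m`
stays above that line once it starts above it. -/
theorem affine_le_of_lt_derivWithin {h : ℝ → ℝ} (hdiff : DifferentiableOn ℝ h (Set.Ici (0 : ℝ)))
    {s c m : ℝ} (hs : 0 ≤ s) (hc : c ≤ h s)
    (hm : ∀ x, s ≤ x → h x = c + m * (x - s) → m < derivWithin h (Set.Ici 0) x)
    {t : ℝ} (ht : s ≤ t) : c + m * (t - s) ≤ h t := by
  refine image_le_of_deriv_right_lt_deriv_boundary' (f := fun x => c + m * (x - s))
    (f' := fun _ => m) (B := h) (B' := derivWithin h (Set.Ici 0)) (a := s) (b := t)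
    (by fun_prop) (fun x _ => ?_) (by simpa using hc)
    (hdiff.continuousOn.mono fun x hx => hs.trans hx.1) (fun x hx => ?_)
    (fun x hx hxe => hm x hx.1 hxe.symm) ⟨ht, le_rfl⟩
  · simpa using ((((hasDerivAt_id x).sub_const s).const_mul m).const_add c).hasDerivWithinAt
  · have hx0 : 0 ≤ x := hs.trans hx.1
    exact (hdiff x hx0).hasDerivWithinAt.mono (Set.Ici_subset_Ici.2 hx0)

/-- A real liminf is nonnegative as soon as the function is eventually above every negative
number; unboundedness is harmless because the supremum of an unbounded set is `0`. -/
theorem Real.liminf_nonneg_of_forall_neg_eventually_le {ι : Type*} {l : Filter ι} {u : ι → ℝ}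
    (hu : ∀ c < 0, ∀ᶠ x in l, c ≤ u x) : 0 ≤ Filter.liminf u l := by
  rw [Filter.liminf_eq]
  by_cases hb : BddAbove {a | ∀ᶠ x in l, a ≤ u x}
  · exact le_of_forall_lt_imp_le_of_dense fun c hc => le_csSup hb (hu c hc)
  · exact (Real.sSup_of_not_bddAbove hb).ge

/-- Recovery property of the BCBF constraint outside the safe set: `h' ≥ −α(h)` with an
extended class-K function `α` implies `h t ≥ min (h 0) 0` for all `t ≥ 0` and
`liminf_{t→∞} h(t) ≥ 0`. -/
theorem stmt_12 (α : ℝ → ℝ) (hα_cont : Continuous α) (hα_mono : StrictMono α)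
    (hα0 : α 0 = 0)
    (h : ℝ → ℝ) (hdiff : DifferentiableOn ℝ h (Set.Ici (0:ℝ)))
    (hineq : ∀ t ∈ Set.Ici (0:ℝ), derivWithin h (Set.Ici 0) t ≥ -α (h t)) :
    (∀ t ∈ Set.Ici (0:ℝ), min (h 0) 0 ≤ h t) ∧
      0 ≤ Filter.liminf h Filter.atTop := by
  have hα_neg : ∀ c < 0, α c < 0 := fun c hc => hα0 ▸ hα_mono hc
  have invariant : ∀ c < 0, ∀ s, 0 ≤ s → c ≤ h s → ∀ t, s ≤ t → c ≤ h t := by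
    intro c hc s hs hcs t ht
    have key := affine_le_of_lt_derivWithin (m := 0) hdiff hs hcs (fun x hx hxc => by
      have hd := hineq x (hs.trans hx)
      rw [hxc, zero_mul, add_zero] at hd
      linarith [hα_neg c hc]) ht
    simpa using key
  refine ⟨fun t ht => le_of_forall_lt_imp_le_of_dense fun c hc => ?_,
    Real.liminf_nonneg_of_forall_neg_eventually_le fun c hc => ?_⟩
  · obtain ⟨hc0, hc⟩ := lt_min_iff.1 hc
    exact invariant c hc 0 le_rfl hc0.le t ht
  · obtain ⟨s, hs, hcs⟩ : ∃ s, 0 ≤ s ∧ c ≤ h s := by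
      by_contra! hlt
      have hδ : 0 < -α c / 2 := by linarith [hα_neg c hc]
      have hT : 0 ≤ (c - h 0) / (-α c / 2) :=
        div_nonneg (sub_nonneg.2 (hlt 0 le_rfl).le) hδ.le
      have key := affine_le_of_lt_derivWithin (m := -α c / 2) hdiff le_rfl le_rfl
        (fun x hx _ => by linarith [hineq x hx, hα_mono (hlt x hx)]) hT
      rw [sub_zero, mul_div_cancel₀ _ hδ.ne'] at key
      linarith [hlt _ hT]
    filter_upwards [Filter.eventually_ge_atTop s] with t ht
    exact invariant c hc s hs hcs t ht
end

section
/- Let U ⊆ ℝ^n be open, let G : U → ℝ^{n×n} be smooth with G(x) symmetric positive definite for every x, let h₀ : U → ℝ be smooth, let ξ : U → ℝ^n be smooth, let α : ℝ → ℝ, and let δ > 0. Define, at each x ∈ U: the Riemannian gradient grad h₀(x) = G(x)⁻¹ ∇h₀(x); α_HS(x) = α(h₀(x)) + ∇h₀(x)·ξ(x); β_HS(x) = ∇h₀(x)ᵀ G(x)⁻¹ ∇h₀(x); λ_HS(x) = 0 if β_HS(x) = 0 and λ_HS(x) = (−α_HS(x) + √(α_HS(x)² + β_HS(x)²))/(2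 β_HS(x)) otherwise; the half-Sontag field ξ_HS(x) = ξ(x) + λ_HS(x) · grad h₀(x); and the augmented field ξ̃(x) = ξ_HS(x) + δ · grad h₀(x). Then for every x ∈ U with ∇h₀(x) ≠ 0: (i) ∇h₀(x)·ξ_HS(x) + α(h₀(x)) = (1/2)(α_HS(x) + √(α_HS(x)² + β_HS(x)²)) > 0; and (ii) ∇h₀(x)·ξ̃(x) + α(h₀(x)) ≥ δ β_HS(x) > 0. -/
open scoped Matrix

/-- The half-Sontag expression `a + √(a² + b²)` is positive as soon as `b ≠ 0`. -/
theorem add_sqrt_sq_add_sq_pos (a : ℝ) {b : ℝ} (hb : b ≠ 0) :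
    0 < a + Real.sqrt (a ^ 2 + b ^ 2) := by
  have h : -a < Real.sqrt (a ^ 2 + b ^ 2) :=
    Real.lt_sqrt_of_sq_lt (by rw [neg_sq]; exact lt_add_of_pos_right _ (by positivity))
  linarith

/-- Pointwise control-barrier inequality of the half-Sontag safety filter: at any point
where `∇h₀ ≠ 0`, the filtered field `ξ_HS` satisfies
`∇h₀·ξ_HS + α(h₀) = (α_HS + √(α_HS² + β_HS²))/2 > 0`, and the `δ`-augmented field `ξ̃`
satisfies `∇h₀·ξ̃ + α(h₀) ≥ δ β_HS > 0`. -/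
theorem stmt_15 {n : ℕ} (U : Set (Fin n → ℝ)) (hU : IsOpen U)
    (G : (Fin n → ℝ) → Matrix (Fin n) (Fin n) ℝ)
    (hG : ∀ i j, ContDiffOn ℝ (⊤ : ℕ∞) (fun y => G y i j) U)
    (hGpd : ∀ y ∈ U, (G y).PosDef)
    (h₀ : (Fin n → ℝ) → ℝ) (hh₀ : ContDiffOn ℝ (⊤ : ℕ∞) h₀ U)
    (ξ : (Fin n → ℝ) → (Fin n → ℝ)) (hξ : ContDiffOn ℝ (⊤ : ℕ∞) ξ U)
    (α : ℝ → ℝ) (δ : ℝ) (hδ : 0 < δ)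
    (gradh : (Fin n → ℝ) → (Fin n → ℝ))
    (hgradh : ∀ y γ, gradh y γ = fderiv ℝ h₀ y (Pi.single γ 1))
    (grad : (Fin n → ℝ) → (Fin n → ℝ))
    (hgrad : ∀ y, grad y = (G y)⁻¹ *ᵥ gradh y)
    (αHS : (Fin n → ℝ) → ℝ)
    (hαHS : ∀ y, αHS y = α (h₀ y) + gradh y ⬝ᵥ ξ y)
    (βHS : (Fin n → ℝ) → ℝ)
    (hβHS : ∀ y, βHS y = gradh y ⬝ᵥ ((G y)⁻¹ *ᵥ gradh y))
    (lamHS : (Fin n → ℝ) → ℝ)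
    (hlamHS : ∀ y, lamHS y = if βHS y = 0 then 0
        else (-αHS y + Real.sqrt ((αHS y) ^ 2 + (βHS y) ^ 2)) / (2 * βHS y))
    (ξHS : (Fin n → ℝ) → (Fin n → ℝ))
    (hξHS : ∀ y, ξHS y = ξ y + lamHS y • grad y)
    (ξtilde : (Fin n → ℝ) → (Fin n → ℝ))
    (hξtilde : ∀ y, ξtilde y = ξHS y + δ • grad y) :
    ∀ y ∈ U, gradh y ≠ 0 →
      (gradh y ⬝ᵥ ξHS y + α (h₀ y)
          = (1/2) * (αHS y + Real.sqrt ((αHS y) ^ 2 + (βHS y) ^ 2))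
        ∧ 0 < gradh y ⬝ᵥ ξHS y + α (h₀ y)) ∧
      (δ * βHS y ≤ gradh y ⬝ᵥ ξtilde y + α (h₀ y) ∧ 0 < δ * βHS y) := by
  intro y hy hne
  have hβ : 0 < βHS y := by
    rw [hβHS]
    simpa using (hGpd y hy).inv.dotProduct_mulVec_pos hne
  have hdot : gradh y ⬝ᵥ grad y = βHS y := by rw [hgrad, hβHS]
  have hlam : lamHS y * βHS y =
      (1/2) * (-αHS y + Real.sqrt ((αHS y) ^ 2 + (βHS y) ^ 2)) := by
    rw [hlamHS, if_neg hβ.ne']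
    field_simp
  have hpos := add_sqrt_sq_add_sq_pos (αHS y) hβ.ne'
  have hHS : gradh y ⬝ᵥ ξHS y + α (h₀ y)
      = (1/2) * (αHS y + Real.sqrt ((αHS y) ^ 2 + (βHS y) ^ 2)) := by
    rw [hξHS, dotProduct_add, dotProduct_smul, smul_eq_mul, hdot, hlam]
    linarith [hαHS y]
  have htilde : gradh y ⬝ᵥ ξtilde y = gradh y ⬝ᵥ ξHS y + δ * βHS y := by
    rw [hξtilde, dotProduct_add, dotProduct_smul, smul_eq_mul, hdot]
  refine ⟨⟨hHS, ?_⟩, ?_, mul_pos hδ hβ⟩ <;> linarith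
end
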